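/- arXiv:2605.28020 — 4 statements merged into one kernel-verified Lean document; each statement's English description precedes it below -/
import Mathlib

section
/- Treat the cut as an auxiliary variable with joint proposal density Q(c, y' ∣ y) = P(c)·Q_c(y' ∣ y). If P(c) > 0 and y, y' ∈ Y agree below c, then the full Metropolis–Hastings proposal–prior ratio equals one: (p(y')·Q(c, y ∣ y')) / (p(y)·Q(c, y' ∣ y)) = 1. -/
open Finset

/-- `y` and `y'` agree below the cut position `c`. -/
def agreeBelow {T : Type*} (L : ℕ) (c : Fin (L + 1)) (y y' : Fin L → T) : Prop :=
  ∀ i : Fin L, (i : ℕ) < (c : ℕ) → y i = y' i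

instance {T : Type*} [DecidableEq T] (L : ℕ) (c : Fin (L + 1)) (y y' : Fin L → T) :
    Decidable (agreeBelow L c y y') := by
  unfold agreeBelow; infer_instance

/-- Prefix marginal `m_c(y) = Σ_{z agreeing with y below c} p(z)`. -/
noncomputable def prefixMarginal {T : Type*} [Fintype T] [DecidableEq T] (L : ℕ)
    (p : (Fin L → T) → ℝ) (c : Fin (L + 1)) (y : Fin L → T) : ℝ :=
  ∑ z : Fin L → T, if agreeBelow L c y z then p z else 0

/-- Suffix-regeneration proposal `Q_c(y' ∣ y)`:  `Qc L p c y y'` is the probability of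
proposing `y'` from current state `y` with cut `c`. -/
noncomputable def Qc {T : Type*} [Fintype T] [DecidableEq T] (L : ℕ)
    (p : (Fin L → T) → ℝ) (c : Fin (L + 1)) (y y' : Fin L → T) : ℝ :=
  if agreeBelow L c y y' then p y' / prefixMarginal L p c y else 0

theorem agreeBelow.refl {T : Type*} {L : ℕ} (c : Fin (L + 1)) (y : Fin L → T) :
    agreeBelow L c y y :=
  fun _ _ => rfl

theorem agreeBelow.symm {T : Type*} {L : ℕ} {c : Fin (L + 1)} {y y' : Fin L → T}
    (h : agreeBelow L c y y') : agreeBelow L c y' y :=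
  fun i hi => (h i hi).symm

theorem agreeBelow.trans {T : Type*} {L : ℕ} {c : Fin (L + 1)} {x y z : Fin L → T}
    (hxy : agreeBelow L c x y) (hyz : agreeBelow L c y z) : agreeBelow L c x z :=
  fun i hi => (hxy i hi).trans (hyz i hi)

theorem prefixMarginal_congr {T : Type*} [Fintype T] [DecidableEq T] {L : ℕ}
    (p : (Fin L → T) → ℝ) {c : Fin (L + 1)} {y y' : Fin L → T} (h : agreeBelow L c y y') :
    prefixMarginal L p c y = prefixMarginal L p c y' :=
  Finset.sum_congr rfl fun _ _ => if_congr ⟨h.symm.trans, h.trans⟩ rfl rfl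

theorem prefixMarginal_pos {T : Type*} [Fintype T] [DecidableEq T] {L : ℕ}
    {p : (Fin L → T) → ℝ} (hp : ∀ y, 0 < p y) (c : Fin (L + 1)) (y : Fin L → T) :
    0 < prefixMarginal L p c y := by
  refine Finset.sum_pos' (fun z _ => ?_) ⟨y, Finset.mem_univ y, ?_⟩
  · split_ifs
    exacts [(hp z).le, le_rfl]
  · rw [if_pos (agreeBelow.refl c y)]
    exact hp y

/-- Treating the cut as an auxiliary variable with joint proposal density
`Q(c, y' ∣ y) = P(c) · Q_c(y' ∣ y)`, if `P c > 0` and `y, y'` agree below `c`, then the full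
Metropolis–Hastings proposal–prior ratio equals one. -/
theorem proposal_prior_cancellation_joint
    {T : Type*} [Fintype T] [DecidableEq T] [Nonempty T] {L : ℕ} (hL : 0 < L)
    (p : (Fin L → T) → ℝ) (hp_pos : ∀ y, 0 < p y) (hp_sum : ∑ y, p y = 1)
    (P : Fin (L + 1) → ℝ) (hP_nonneg : ∀ c, 0 ≤ P c) (hP_sum : ∑ c, P c = 1)
    (c : Fin (L + 1)) (hPc : 0 < P c)
    (y y' : Fin L → T) (h : agreeBelow L c y y') :
    (p y' * (P c * Qc L p c y' y)) / (p y * (P c * Qc L p c y y')) = 1 := by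
  have hm := (prefixMarginal_pos hp_pos c y').ne'
  have hy := (hp_pos y).ne'
  have hy' := (hp_pos y').ne'
  have hc := hPc.ne'
  rw [Qc, Qc, if_pos h, if_pos h.symm, prefixMarginal_congr p h]
  field_simp
end

section
/- The cut-mixture proposal kernel is reversible with respect to the prior: for all y, y' ∈ Y, p(y)·Q(y' ∣ y) = p(y')·Q(y ∣ y'), where Q(y' ∣ y) = Σ_{c ∈ Fin (L+1)} P(c)·Q_c(y' ∣ y). -/
open Finset

/-- Cut-mixture proposal `Q(y' ∣ y) = Σ_c P(c) · Q_c(y' ∣ y)`. -/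
noncomputable def Qmix {T : Type*} [Fintype T] [DecidableEq T] (L : ℕ)
    (p : (Fin L → T) → ℝ) (P : Fin (L + 1) → ℝ) (y y' : Fin L → T) : ℝ :=
  ∑ c : Fin (L + 1), P c * Qc L p c y y'

theorem agreeBelow_comm {T : Type*} {L : ℕ} {c : Fin (L + 1)} {y y' : Fin L → T} :
    agreeBelow L c y y' ↔ agreeBelow L c y' y :=
  ⟨fun h i hi => (h i hi).symm, fun h i hi => (h i hi).symm⟩

/-- Each fixed-cut proposal satisfies detailed balance with respect to `p`. -/
theorem mul_Qc_comm {T : Type*} [Fintype T] [DecidableEq T] {L : ℕ}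
    (p : (Fin L → T) → ℝ) (c : Fin (L + 1)) (y y' : Fin L → T) :
    p y * Qc L p c y y' = p y' * Qc L p c y' y := by
  by_cases h : agreeBelow L c y y'
  · rw [Qc, Qc, if_pos h, if_pos (agreeBelow_comm.1 h), prefixMarginal_congr p h]
    ring
  · rw [Qc, Qc, if_neg h, if_neg (mt agreeBelow_comm.1 h), mul_zero, mul_zero]

/-- The cut-mixture proposal kernel is reversible with respect to the prior. -/
theorem mixture_proposal_reversible
    {T : Type*} [Fintype T] [DecidableEq T] [Nonempty T] {L : ℕ} (hL : 0 < L)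
    (p : (Fin L → T) → ℝ) (hp_pos : ∀ y, 0 < p y) (hp_sum : ∑ y, p y = 1)
    (P : Fin (L + 1) → ℝ) (hP_nonneg : ∀ c, 0 ≤ P c) (hP_sum : ∑ c, P c = 1) :
    ∀ y y' : Fin L → T, p y * Qmix L p P y y' = p y' * Qmix L p P y' y := by
  intro y y'
  simp only [Qmix, Finset.mul_sum]
  refine Finset.sum_congr rfl fun c _ => ?_
  rw [mul_left_comm, mul_Qc_comm, mul_left_comm]
end

section
/- The reward-comparison acceptance rule satisfies detailed balance with respect to the reward-tilted target: for all y, y' ∈ Y, π_β(y)·Q(y' ∣ y)·α(y, y') = π_β(y')·Q(y ∣ y')·α(y', y), where α(y, y') = min(1, exp(β·(S(y') − S(y)))). -/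
open Finset

/-- Partition function `Z_β = Σ_y p(y) · exp(β · S(y))`. -/
noncomputable def Zbeta {Y : Type*} [Fintype Y] (p : Y → ℝ) (S : Y → ℝ) (β : ℝ) : ℝ :=
  ∑ y, p y * Real.exp (β * S y)

/-- Reward-tilted distribution `π_β(y) = p(y) · exp(β · S(y)) / Z_β`. -/
noncomputable def piBeta {Y : Type*} [Fintype Y] (p : Y → ℝ) (S : Y → ℝ) (β : ℝ) (y : Y) : ℝ :=
  p y * Real.exp (β * S y) / Zbeta p S β

/-- Reward-comparison Metropolis–Hastings acceptance probability
`α(y, y') = min(1, exp(β · (S(y') − S(y))))`. -/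
noncomputable def accept {Y : Type*} (β : ℝ) (S : Y → ℝ) (y y' : Y) : ℝ :=
  min 1 (Real.exp (β * (S y' - S y)))

/-- The cut-mixture proposal is reversible with respect to the prior. -/
theorem mul_Qmix_comm {T : Type*} [Fintype T] [DecidableEq T] {L : ℕ}
    (p : (Fin L → T) → ℝ) (P : Fin (L + 1) → ℝ) (y y' : Fin L → T) :
    p y * Qmix L p P y y' = p y' * Qmix L p P y' y := by
  simp only [Qmix, Finset.mul_sum, mul_left_comm _ (P _), mul_Qc_comm p _ y y']

theorem exp_mul_accept {Y : Type*} (β : ℝ) (S : Y → ℝ) (y y' : Y) :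
    Real.exp (β * S y) * accept β S y y' =
      min (Real.exp (β * S y)) (Real.exp (β * S y')) := by
  rw [accept, mul_min_of_nonneg _ _ (Real.exp_nonneg _), mul_one, ← Real.exp_add]
  ring_nf

theorem exp_mul_accept_comm {Y : Type*} (β : ℝ) (S : Y → ℝ) (y y' : Y) :
    Real.exp (β * S y) * accept β S y y' = Real.exp (β * S y') * accept β S y' y := by
  rw [exp_mul_accept, exp_mul_accept, min_comm]

/-- The reward-comparison acceptance rule satisfies detailed balance with
respect to the reward-tilted target. -/
theorem detailed_balance_reward_tilted
    {T : Type*} [Fintype T] [DecidableEq T] [Nonempty T] {L : ℕ} (hL : 0 < L)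
    (p : (Fin L → T) → ℝ) (hp_pos : ∀ y, 0 < p y) (hp_sum : ∑ y, p y = 1)
    (P : Fin (L + 1) → ℝ) (hP_nonneg : ∀ c, 0 ≤ P c) (hP_sum : ∑ c, P c = 1)
    (S : (Fin L → T) → ℝ) (β : ℝ) (hβ : 0 < β) :
    ∀ y y' : Fin L → T,
      piBeta p S β y * Qmix L p P y y' * accept β S y y'
        = piBeta p S β y' * Qmix L p P y' y * accept β S y' y := by
  intro y y'
  calc piBeta p S β y * Qmix L p P y y' * accept β S y y'
      = (p y * Qmix L p P y y') * (Real.exp (β * S y) * accept β S y y') / Zbeta p S β := by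
        unfold piBeta; ring
    _ = (p y' * Qmix L p P y' y) * (Real.exp (β * S y') * accept β S y' y) / Zbeta p S β := by
        rw [mul_Qmix_comm, exp_mul_accept_comm]
    _ = piBeta p S β y' * Qmix L p P y' y * accept β S y' y := by
        unfold piBeta; ring
end

section
/- The expected score under the reward-tilted distribution is monotone in the inverse temperature: for all real β₁, β₂ with 0 < β₁ ≤ β₂, Σ_{y} π_{β₁}(y)·S(y) ≤ Σ_{y} π_{β₂}(y)·S(y). -/
open Finset

/-- Kullback–Leibler divergence `KL(q ∥ p) = Σ_y q(y) · log(q(y)/p(y))`, with the convention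
`0 · log 0 = 0` (in Lean, `Real.log 0 = 0`, so the summand vanishes when `q y = 0`). -/
noncomputable def KL {Y : Type*} [Fintype Y] (q p : Y → ℝ) : ℝ :=
  ∑ y, q y * Real.log (q y / p y)

/-- A Chebyshev-type inequality: if the ratio of the weights `b` and `a` increases with `f`, then
the `b`-weighted sum of `f` dominates the `a`-weighted one, up to normalisation. -/
theorem sum_mul_mul_sum_le_of_ratio_monotone {ι : Type*} [Fintype ι] (a b f : ι → ℝ)
    (h : ∀ x y, 0 ≤ (f x - f y) * (b x * a y - a x * b y)) :
    (∑ x, a x * f x) * ∑ x, b x ≤ (∑ x, b x * f x) * ∑ x, a x := by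
  have hnonneg : 0 ≤ ∑ x, ∑ y, (f x - f y) * (b x * a y - a x * b y) :=
    sum_nonneg fun x _ => sum_nonneg fun y _ => h x y
  have hsum : ∑ x, ∑ y, (f x - f y) * (b x * a y - a x * b y) =
      2 * ((∑ x, b x * f x) * ∑ x, a x - (∑ x, a x * f x) * ∑ x, b x) := by
    calc _ = ∑ x, ∑ y, ((b x * f x) * a y - (a x * f x) * b y
            - b x * (a y * f y) + a x * (b y * f y)) :=
          sum_congr rfl fun x _ => sum_congr rfl fun y _ => by ring
      _ = _ := by
          simp only [sum_add_distrib, sum_sub_distrib, ← sum_mul_sum]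
          ring
  linarith

theorem Zbeta_pos {Y : Type*} [Fintype Y] [Nonempty Y] {p : Y → ℝ} (hp : ∀ y, 0 < p y)
    (S : Y → ℝ) (β : ℝ) : 0 < Zbeta p S β :=
  sum_pos (fun y _ => mul_pos (hp y) (Real.exp_pos _)) univ_nonempty

theorem sum_piBeta_mul {Y : Type*} [Fintype Y] (p S : Y → ℝ) (β : ℝ) :
    ∑ y, piBeta p S β y * S y = (∑ y, p y * Real.exp (β * S y) * S y) / Zbeta p S β := by
  simp only [piBeta, sum_div, div_mul_eq_mul_div]

/-- The expected score under the reward-tilted distribution is monotone in the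
inverse temperature. -/
theorem expected_score_monotone_in_beta
    {Y : Type*} [Fintype Y] [Nonempty Y]
    (p : Y → ℝ) (hp_pos : ∀ y, 0 < p y) (hp_sum : ∑ y, p y = 1)
    (S : Y → ℝ) :
    ∀ β₁ β₂ : ℝ, 0 < β₁ → β₁ ≤ β₂ →
      ∑ y, piBeta p S β₁ y * S y ≤ ∑ y, piBeta p S β₂ y * S y := by
  intro β₁ β₂ _ hβ
  rw [sum_piBeta_mul, sum_piBeta_mul, div_le_div_iff₀ (Zbeta_pos hp_pos S _) (Zbeta_pos hp_pos S _)]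
  refine sum_mul_mul_sum_le_of_ratio_monotone _ _ _ fun x y => ?_
  have hfactor : p x * Real.exp (β₂ * S x) * (p y * Real.exp (β₁ * S y)) -
      p x * Real.exp (β₁ * S x) * (p y * Real.exp (β₂ * S y)) =
      p x * p y * (Real.exp (β₂ * S x + β₁ * S y) - Real.exp (β₁ * S x + β₂ * S y)) := by
    rw [Real.exp_add, Real.exp_add]
    ring
  rw [hfactor]
  have hp : 0 ≤ p x * p y := (mul_pos (hp_pos x) (hp_pos y)).le
  rcases le_total (S x) (S y) with hS | hS
  · refine mul_nonneg_of_nonpos_of_nonpos (sub_nonpos.2 hS)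
      (mul_nonpos_of_nonneg_of_nonpos hp (sub_nonpos.2 (Real.exp_le_exp.2 ?_)))
    nlinarith
  · refine mul_nonneg (sub_nonneg.2 hS)
      (mul_nonneg hp (sub_nonneg.2 (Real.exp_le_exp.2 ?_)))
    nlinarith
end
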